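/- Let n ≥ 3 and let λ be a Jordan multiplication on ℂⁿ. Then λ has level two if and only if λ is isomorphic to one of the following three multiplications: J₁, J₂, or J₃. -/

import Mathlib

noncomputable section

abbrev V (n : ℕ) : Type := Fin n → ℂ

abbrev Bil (n : ℕ) : Type := V n →ₗ[ℂ] V n →ₗ[ℂ] V n

instance BilTop (n : ℕ) : TopologicalSpace (Bil n) :=
  TopologicalSpace.induced (fun μ : Bil n => fun x y : V n => μ x y) inferInstance

/-- The change-of-basis action of a linear automorphism on multiplications. -/
def act {n : ℕ} (g : V n ≃ₗ[ℂ] V n) (μ : Bil n) : Bil n :=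
  LinearMap.mk₂ ℂ (fun x y => g (μ (g.symm x) (g.symm y)))
    (fun x x' y => by simp)
    (fun c x y => by simp)
    (fun x y y' => by simp)
    (fun c x y => by simp)

/-- The orbit of a multiplication under the change-of-basis action. -/
def orb {n : ℕ} (μ : Bil n) : Set (Bil n) :=
  Set.range fun g : V n ≃ₗ[ℂ] V n => act g μ

/-- Two multiplications are isomorphic iff they lie in the same orbit. -/
def Isom {n : ℕ} (μ ν : Bil n) : Prop := ∃ g : V n ≃ₗ[ℂ] V n, act g μ = ν

def levelOne {n : ℕ} (lam : Bil n) : Prop :=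
  lam ≠ 0 ∧ closure (orb lam) ⊆ orb lam ∪ {0}

def levelTwo {n : ℕ} (lam : Bil n) : Prop :=
  (∀ μ ∈ closure (orb lam) \ orb lam, closure (orb μ) ⊆ orb μ ∪ {0}) ∧
  ∃ μ ∈ closure (orb lam) \ orb lam, μ ≠ 0

/-- `E n k` is the standard basis vector `e_{k+1}` of `ℂⁿ` (0-indexed `k`). -/
def E (n k : ℕ) : V n := fun m => if (m : ℕ) = k then 1 else 0

/-- The bilinear multiplication determined by a table of products of basis vectors. -/
def ofTable {n : ℕ} (c : Fin n → Fin n → V n) : Bil n :=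
  LinearMap.mk₂ ℂ (fun x y => ∑ i : Fin n, ∑ j : Fin n, (x i * y j) • c i j)
    (fun x x' y => by
      simp [add_mul, add_smul, Finset.sum_add_distrib])
    (fun a x y => by
      simp [Finset.smul_sum, smul_smul, mul_assoc])
    (fun x y y' => by
      simp [mul_add, add_smul, Finset.sum_add_distrib])
    (fun a x y => by
      simp [Finset.smul_sum, smul_smul, mul_assoc, mul_left_comm])

def JordanMul {n : ℕ} (lam : Bil n) : Prop :=
  (∀ x y : V n, lam x y = lam y x) ∧
  ∀ x y : V n, lam (lam x x) (lam y x) = lam (lam (lam x x) y) x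

def LieMul {n : ℕ} (lam : Bil n) : Prop :=
  (∀ x : V n, lam x x = 0) ∧
  ∀ x y z : V n, lam x (lam y z) + lam y (lam z x) + lam z (lam x y) = 0

def AssocMul {n : ℕ} (lam : Bil n) : Prop :=
  ∀ x y z : V n, lam (lam x y) z = lam x (lam y z)
/-- `J₁`: `e₁·e₁ = e₁`. -/
def J1 (n : ℕ) : Bil n :=
  ofTable fun i j => if i.val = 0 ∧ j.val = 0 then E n 0 else 0

/-- `J₂`: `e₁·e₁ = e₁`, `e₁·eᵢ = eᵢ·e₁ = eᵢ` for `2 ≤ i ≤ n`. -/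
def J2 (n : ℕ) : Bil n :=
  ofTable fun i j =>
    if i.val = 0 then E n j.val else if j.val = 0 then E n i.val else 0

/-- `J₃`: `e₁·e₂ = e₂·e₁ = e₃`. -/
def J3 (n : ℕ) : Bil n :=
  ofTable fun i j =>
    if (i.val = 0 ∧ j.val = 1) ∨ (i.val = 1 ∧ j.val = 0) then E n 2 else 0



section partA
variable {U : Type*} [AddCommGroup U] [Module ℂ U]

lemma poly4 {a b c d : ℂ} (h : ∀ t : ℂ, a * t + b * t ^ 2 + c * t ^ 3 + d * t ^ 4 = 0) :
    a = 0 ∧ b = 0 ∧ c = 0 ∧ d = 0 := by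
  have h1 := h 1
  have h2 := h (-1)
  have h3 := h 2
  have h4 := h (-2)
  refine ⟨?_, ?_, ?_, ?_⟩
  · linear_combination (2/3) * h1 - (2/3) * h2 - (1/12) * h3 + (1/12) * h4
  · linear_combination (2/3) * h1 + (2/3) * h2 - (1/24) * h3 - (1/24) * h4
  · linear_combination (-1/6) * h1 + (1/6) * h2 + (1/12) * h3 - (1/12) * h4
  · linear_combination (-1/6) * h1 - (1/6) * h2 + (1/24) * h3 + (1/24) * h4

lemma sep {x : U} (h : ∀ φ : Module.Dual ℂ U, φ x = 0) : x = 0 :=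
  (Module.forall_dual_apply_eq_zero_iff ℂ x).1 h

lemma sep' {x y : U} (h : ∀ φ : Module.Dual ℂ U, φ x = φ y) : x = y := by
  rw [← sub_eq_zero]
  exact sep fun φ => by simp [h φ]

lemma sep2 {D P : Module.Dual ℂ U} {e p : U} (De : D e = 1) (Dp : D p = 0)
    (Pe : P e = 0) (Pp : P p = 1) {x : U} (h1 : D x = 0) (h2 : P x = 0)
    (h : ∀ ψ : Module.Dual ℂ U, ψ e = 0 → ψ p = 0 → ψ x = 0) : x = 0 := by
  refine sep fun φ => ?_
  have := h (φ - φ e • D - φ p • P) (by simp [De, Pe]) (by simp [Dp, Pp])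
  simpa [h1, h2] using this

lemma scalar {D P : Module.Dual ℂ U} {e p : U} (A : U →ₗ[ℂ] U) {w₀ : U} {ω : Module.Dual ℂ U}
    (ωe : ω e = 0) (ωp : ω p = 0) (ωw : ω w₀ = 1) (Dw : D w₀ = 0) (Pw : P w₀ = 0)
    (h : ∀ (ψ : Module.Dual ℂ U) (w : U), ψ e = 0 → ψ p = 0 → D w = 0 → P w = 0 → ψ w = 0 →
      ψ (A w) = 0) :
    ∃ c : ℂ, ∀ (ψ : Module.Dual ℂ U) (w : U), ψ e = 0 → ψ p = 0 → D w = 0 → P w = 0 →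
      ψ (A w) = c * ψ w := by
  refine ⟨ω (A w₀), ?_⟩
  have key : ∀ (ψ : Module.Dual ℂ U) (w : U), ψ e = 0 → ψ p = 0 → D w = 0 → P w = 0 →
      ψ w₀ ≠ 0 → ψ (A w) = ω (A w₀) * ψ w := by
    intro ψ w he hp hD hP h0
    have h1 := h (ψ - ψ w₀ • ω) w₀ (by simp [he, ωe]) (by simp [hp, ωp]) Dw Pw (by simp [ωw])
    have h2 := h ψ (ψ w₀ • w - ψ w • w₀) he hp (by simp [hD, Dw]) (by simp [hP, Pw])
      (by simp [mul_comm])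
    simp at h1 h2
    apply mul_left_cancel₀ h0
    linear_combination h2 + ψ w * h1
  intro ψ w he hp hD hP
  by_cases h0 : ψ w₀ = 0
  · have h1 := key (ψ + ω) w (by simp [he, ωe]) (by simp [hp, ωp]) hD hP (by simp [h0, ωw])
    have h2 := key ω w ωe ωp hD hP (by simp [ωw])
    simp at h1
    linear_combination h1 - h2
  · exact key ψ w he hp hD hP h0

def HH (m : U →ₗ[ℂ] U →ₗ[ℂ] U) : Prop :=
  ∀ (φ : Module.Dual ℂ U) (u v : U), φ u = 0 → φ v = 0 →
    φ (m u u) * φ (m v v) = φ (m u v) ^ 2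

def FG (m : U →ₗ[ℂ] U →ₗ[ℂ] U) : Prop :=
  ∃ (f g : Module.Dual ℂ U) (v : U), ∀ x y, m x y = f x • y + f y • x + (g x * g y) • v

/-- subtract `f x • y + f y • x` -/
def subF (m : U →ₗ[ℂ] U →ₗ[ℂ] U) (f : Module.Dual ℂ U) : U →ₗ[ℂ] U →ₗ[ℂ] U :=
  LinearMap.mk₂ ℂ (fun x y => m x y - f x • y - f y • x)
    (fun x x' y => by simp [add_smul]; abel)
    (fun c x y => by simp [smul_sub, smul_smul, mul_comm])
    (fun x y y' => by simp [add_smul]; abel)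
    (fun c x y => by simp [smul_sub, smul_smul, mul_comm])

lemma subF_apply (m : U →ₗ[ℂ] U →ₗ[ℂ] U) (f : Module.Dual ℂ U) (x y : U) :
    subF m f x y = m x y - f x • y - f y • x := rfl

lemma HH_subF {m : U →ₗ[ℂ] U →ₗ[ℂ] U} (h : HH m) (f : Module.Dual ℂ U) : HH (subF m f) := by
  intro φ u v hu hv
  simpa [subF_apply, hu, hv] using h φ u v hu hv

lemma FG_subF {m : U →ₗ[ℂ] U →ₗ[ℂ] U} {f : Module.Dual ℂ U} (h : FG (subF m f)) : FG m := by
  obtain ⟨f', g, v, h⟩ := h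
  refine ⟨f + f', g, v, fun x y => ?_⟩
  have := h x y
  rw [subF_apply] at this
  rw [sub_sub, sub_eq_iff_eq_add] at this
  rw [this]; simp [add_smul]; abel

/-- last step: everything but `ep`, `pp` known. -/
lemma core3 (m : U →ₗ[ℂ] U →ₗ[ℂ] U) (hs : ∀ x y, m x y = m y x) (H : HH m)
    {D P : Module.Dual ℂ U} {e p : U} (De : D e = 1) (Dp : D p = 0)
    (Pe : P e = 0) (Pp : P p = 1) (hee : m e e = p)
    (hew : ∀ w, D w = 0 → P w = 0 → m e w = 0)
    (hpw : ∀ w, D w = 0 → P w = 0 → m p w = 0)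
    (hww : ∀ w w', D w = 0 → P w = 0 → D w' = 0 → P w' = 0 → m w w' = 0)
    {w₀ : U} {ω : Module.Dual ℂ U}
    (ωe : ω e = 0) (ωp : ω p = 0) (ωw : ω w₀ = 1) (Dw : D w₀ = 0) (Pw : P w₀ = 0) : FG m := by
  have key : ∀ φ : Module.Dual ℂ U, φ w₀ ≠ 0 → φ p * φ (m p p) = φ (m e p) ^ 2 := by
    intro φ h0
    have h1 := H φ (φ w₀ • e - φ e • w₀) (φ w₀ • p - φ p • w₀) (by simp [mul_comm])
      (by simp [mul_comm])
    have e1 := hew w₀ Dw Pw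
    have e2 := hpw w₀ Dw Pw
    have e3 := hww w₀ w₀ Dw Pw Dw Pw
    have e4 : m w₀ e = 0 := by rw [hs, e1]
    have e5 : m w₀ p = 0 := by rw [hs, e2]
    simp [e1, e2, e3, e4, e5, hee] at h1
    apply mul_left_cancel₀ (pow_ne_zero 4 h0)
    linear_combination h1
  have k1 : ∀ φ : Module.Dual ℂ U, φ w₀ ≠ 0 → φ p = 0 → φ (m e p) = 0 := by
    intro φ h0 hp
    have := key φ h0
    rw [hp, zero_mul] at this
    exact pow_eq_zero_iff (two_ne_zero) |>.1 this.symm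
  have k2 : ∀ φ : Module.Dual ℂ U, φ p = 0 → φ (m e p) = 0 := by
    intro φ hp
    by_cases h0 : φ w₀ = 0
    · have h1 := k1 (φ + ω) (by simp [h0, ωw]) (by simp [hp, ωp])
      have h2 := k1 ω (by simp [ωw]) ωp
      simpa [h2] using h1
    · exact k1 φ h0 hp
  set γ := P (m e p) with hγ
  have hep : m e p = γ • p := by
    refine sep' fun φ => ?_
    have := k2 (φ - φ p • P) (by simp [Pp])
    simp at this
    simp only [map_smul, smul_eq_mul]
    linear_combination this
  have k3 : ∀ φ : Module.Dual ℂ U, φ w₀ ≠ 0 → φ p ≠ 0 → φ (m p p) = γ ^ 2 * φ p := by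
    intro φ h0 hp
    have := key φ h0
    rw [hep] at this
    simp at this
    apply mul_left_cancel₀ hp
    linear_combination this
  have k4 : ∀ φ : Module.Dual ℂ U, φ (m p p) = γ ^ 2 * φ p := by
    intro φ
    -- find t with φ + t(ω+P) good and t(ω+P) good
    obtain ⟨t, ht⟩ := Set.Infinite.exists_notMem_finset (Set.infinite_univ (α := ℂ))
      ({0, -(φ w₀), -(φ p)} : Finset ℂ)
    simp at ht
    obtain ⟨t0, t1, t2⟩ := ht
    have a1 := k3 (φ + t • (ω + P)) (by simpa [ωw, Pw] using fun h => t1 (by linear_combination h))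
      (by simpa [ωp, Pp] using fun h => t2 (by linear_combination h))
    have a2 := k3 (t • (ω + P)) (by simp [ωw, Pw, t0]) (by simp [ωp, Pp, t0])
    simp only [LinearMap.add_apply] at a1
    linear_combination a1 - a2
  have hpp : m p p = γ ^ 2 • p := sep' fun φ => by simp [k4]
  refine ⟨0, D + γ • P, p, fun x y => ?_⟩
  have dec : ∀ x : U, ∃ w, D w = 0 ∧ P w = 0 ∧ x = D x • e + P x • p + w := fun x =>
    ⟨x - D x • e - P x • p, by simp [De, Dp], by simp [Pe, Pp], by abel⟩
  obtain ⟨w, w1, w2, hx⟩ := dec x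
  obtain ⟨z, z1, z2, hy⟩ := dec y
  have e1 := hew w w1 w2
  have e2 := hpw w w1 w2
  have e1' := hew z z1 z2
  have e2' := hpw z z1 z2
  have e3 := hww w z w1 w2 z1 z2
  rw [hs] at e1 e2
  have hpe : m p e = γ • p := by rw [hs, hep]
  conv_lhs => rw [hx, hy]
  simp only [map_add, map_smul, LinearMap.add_apply, LinearMap.smul_apply, e1, e2, e1', e2', e3,
    hee, hep, hpp, hpe, LinearMap.zero_apply, smul_eq_mul]
  module



/-- middle step. -/
lemma core2 (m : U →ₗ[ℂ] U →ₗ[ℂ] U) (hs : ∀ x y, m x y = m y x) (H : HH m)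
    {D P : Module.Dual ℂ U} {e p : U} (De : D e = 1) (Dp : D p = 0)
    (Pe : P e = 0) (Pp : P p = 1) (hee : m e e = p)
    (hew : ∀ w, D w = 0 → P w = 0 → m e w = 0)
    {w₀ : U} {ω : Module.Dual ℂ U}
    (ωe : ω e = 0) (ωp : ω p = 0) (ωw : ω w₀ = 1) (Dw : D w₀ = 0) (Pw : P w₀ = 0) : FG m := by
  have f1 : ∀ w, D w = 0 → P w = 0 → P (m w w) = 0 := by
    intro w hD hP
    have := H P e w Pe hP
    simpa [hee, Pp, hew w hD hP] using this
  have f2 : ∀ (ψ : Module.Dual ℂ U) w, ψ e = 0 → ψ p = 0 → D w = 0 → P w = 0 → ψ w = 0 →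
      ψ (m w w) = 0 := by
    intro ψ w he hp hD hP hw
    have := H (P + ψ) e w (by simp [Pe, he]) (by simp [hP, hw])
    simpa [hee, Pp, hew w hD hP, hp, f1 w hD hP] using this
  have f3 : ∀ w, D w = 0 → P w = 0 → D (m w w) = 0 := by
    intro w hD hP
    have := poly4 (a := - D (m w w)) (b := - D (m w w) * (2 * P (m e p)) - P (m p w) ^ 2)
      (c := - D (m w w) * (P (m p p) - 2 * D (m e p)) + 2 * P (m p w) * D (m p w))
      (d := D (m w w) * D (m p p) - D (m p w) ^ 2) (fun α => by
        have := H (P - α • D) (e + α • p) w (by simp [Pe, De, Pp, Dp]) (by simp [hP, hD])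
        have h2 : m p e = m e p := hs _ _
        simp [hee, Pp, hew w hD hP, h2, f1 w hD hP, Dp] at this
        linear_combination this)
    simpa using this.1
  have f4 : ∀ w, D w = 0 → P w = 0 → D (m p w) = 0 := by
    intro w hD hP
    have := H D p w Dp hD
    rw [f3 w hD hP] at this
    simpa using this.symm
  have f5 : ∀ (ψ : Module.Dual ℂ U) w, ψ e = 0 → ψ p = 0 → D w = 0 → P w = 0 → ψ w = 0 →
      ψ (m p w) = 0 := by
    intro ψ w he hp hD hP hw
    have := H ψ p w hp hw
    rw [f2 ψ w he hp hD hP hw] at this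
    simpa using this.symm
  have f6 : ∀ (ψ : Module.Dual ℂ U) w, ψ e = 0 → ψ p = 0 → D w = 0 → P w = 0 → ψ w = 1 →
      ψ (m w w) = 0 ∧ P (m p w) = 0 := by
    intro ψ w he hp hD hP hw
    set h := ψ (m w w) with hh
    set k := P (m p w) with hk
    have hpe : m p e = m e p := hs _ _
    have hwp : m w p = m p w := hs _ _
    have hwe : m w e = 0 := by rw [hs, hew w hD hP]
    -- the identity for all α, β
    have key : ∀ α β : ℂ, (1 - α ^ 2 * β * h) *
        (- β * h + 2 * β * (k - β * ψ (m p w)) +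
          β ^ 2 * (P (m p p) - β * ψ (m p p) + α * β * D (m p p))) =
        (- α * β * h + β * (P (m e p) - β * ψ (m e p) + α * β * D (m e p)) +
          α * β * (k - β * ψ (m p w))) ^ 2 := by
      intro α β
      have := H (P - β • ψ + (α * β) • D) (e + α • w) (w + β • p)
        (by simp [Pe, he, De, hP, hw, hD]; ring) (by simp [hP, hw, hD, Pp, hp, Dp])
      simp [hee, hew w hD hP, hpe, hwp, hwe, f1 w hD hP, f3 w hD hP, f4 w hD hP, Pp, hp, Dp,
        ← hh, ← hk] at this
      linear_combination this
    have hA : ∀ α : ℂ, (- h + 2 * k = 0) ∧ (- 2 * ψ (m p w) + P (m p p)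
        - α ^ 2 * h * (- h + 2 * k) = (- α * h + P (m e p) + α * k) ^ 2) := by
      intro α
      have := poly4 (a := -h + 2 * k)
        (b := - 2 * ψ (m p w) + P (m p p) - α ^ 2 * h * (- h + 2 * k)
          - (- α * h + P (m e p) + α * k) ^ 2)
        (c := (- ψ (m p p) + α * D (m p p)) - α ^ 2 * h * (- 2 * ψ (m p w) + P (m p p))
          - 2 * (- α * h + P (m e p) + α * k) * (- ψ (m e p) + α * D (m e p) - α * ψ (m p w)))
        (d := - α ^ 2 * h * (- ψ (m p p) + α * D (m p p))
          - (- ψ (m e p) + α * D (m e p) - α * ψ (m p w)) ^ 2)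
        (fun β => by linear_combination key α β)
      exact ⟨this.1, by linear_combination this.2.1⟩
    have h1 := (hA 0).1
    have h2 := (hA 0).2
    have h3 := (hA 1).2
    have h4 := (hA (-1)).2
    have hk0 : k ^ 2 = 0 := by
      have : h = 2 * k := by linear_combination -h1
      rw [this] at h2 h3 h4
      linear_combination h2 - (h3 + h4) / 2
    have hk1 : k = 0 := pow_eq_zero_iff (two_ne_zero) |>.1 hk0
    exact ⟨by linear_combination -h1 + 2 * hk1, hk1⟩
  -- squares vanish
  have ex : ∀ w, D w = 0 → P w = 0 → w ≠ 0 → ∃ ψ : Module.Dual ℂ U, ψ e = 0 ∧ ψ p = 0 ∧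
      ψ w = 1 := by
    intro w hD hP hw
    have : ∃ φ : Module.Dual ℂ U, φ w ≠ 0 := by
      by_contra hc
      push Not at hc
      exact hw (sep hc)
    obtain ⟨φ, hφ⟩ := this
    refine ⟨(φ w)⁻¹ • (φ - φ e • D - φ p • P), by simp [De, Pe], by simp [Dp, Pp], ?_⟩
    simp [hD, hP, hφ]
  have g1 : ∀ w, D w = 0 → P w = 0 → m w w = 0 := by
    intro w hD hP
    by_cases hw : w = 0
    · simp [hw]
    obtain ⟨ψ, he, hp, h1⟩ := ex w hD hP hw
    refine sep2 De Dp Pe Pp (f3 w hD hP) (f1 w hD hP) fun χ χe χp => ?_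
    have := f2 (χ - χ w • ψ) w (by simp [χe, he]) (by simp [χp, hp]) hD hP (by simp [h1])
    simpa [(f6 ψ w he hp hD hP h1).1] using this
  have g2 : ∀ w w', D w = 0 → P w = 0 → D w' = 0 → P w' = 0 → m w w' = 0 := by
    intro w w' h1 h2 h3 h4
    have := g1 (w + w') (by simp [h1, h3]) (by simp [h2, h4])
    simp [g1 w h1 h2, g1 w' h3 h4, hs w' w] at this
    have h : (2 : ℂ) • m w w' = 0 := by rw [two_smul]; exact this
    simpa using h
  have g3 : ∀ w, D w = 0 → P w = 0 → P (m p w) = 0 := by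
    intro w hD hP
    by_cases hw : w = 0
    · simp [hw]
    obtain ⟨ψ, he, hp, h1⟩ := ex w hD hP hw
    exact (f6 ψ w he hp hD hP h1).2
  obtain ⟨c, hc⟩ := scalar (D := D) (P := P) (e := e) (p := p) (m p) ωe ωp ωw Dw Pw f5
  have g4 : ∀ w, D w = 0 → P w = 0 → m p w = c • w := by
    intro w hD hP
    rw [← sub_eq_zero]
    refine sep2 De Dp Pe Pp (by simp [f4 w hD hP, hD]) (by simp [g3 w hD hP, hP])
      fun ψ he hp => ?_
    simp [hc ψ w he hp hD hP]
  apply FG_subF (f := c • P)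
  refine core3 (subF m (c • P)) (fun x y => ?_) (HH_subF H _) De Dp Pe Pp ?_ ?_ ?_ ?_ ωe ωp ωw Dw Pw
  · simp only [subF_apply, hs x y]; abel
  · simp [subF_apply, hee, Pe]
  · intro w h1 h2
    simp [subF_apply, hew w h1 h2, Pe, h2]
  · intro w h1 h2
    simp [subF_apply, g4 w h1 h2, Pp, h2]
  · intro w w' h1 h2 h3 h4
    simp [subF_apply, g2 w w' h1 h2 h3 h4, h2, h4]

lemma core1 (m : U →ₗ[ℂ] U →ₗ[ℂ] U) (hs : ∀ x y, m x y = m y x) (H : HH m)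
    {D P : Module.Dual ℂ U} {e p : U} (De : D e = 1) (Dp : D p = 0)
    (Pe : P e = 0) (Pp : P p = 1) (hee : m e e = p)
    {w₀ : U} {ω : Module.Dual ℂ U}
    (ωe : ω e = 0) (ωp : ω p = 0) (ωw : ω w₀ = 1) (Dw : D w₀ = 0) (Pw : P w₀ = 0) : FG m := by
  obtain ⟨c, hc⟩ := scalar (D := D) (P := P) (e := e) (p := p) (m e) ωe ωp ωw Dw Pw (by
    intro ψ w he hp hD hP hw
    have := H ψ e w he hw
    rw [hee, hp, zero_mul] at this
    simpa using this.symm)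
  -- projection to W
  let pr : U →ₗ[ℂ] U := LinearMap.id - D.smulRight e - P.smulRight p
  have hpr : ∀ x, pr x = x - D x • e - P x • p := fun x => by simp [pr]
  let D1 : Module.Dual ℂ U := D + P ∘ₗ (m e) ∘ₗ pr
  have hD1 : ∀ x, D1 x = D x + P (m e (pr x)) := fun x => by simp [D1]
  have pre : pr e = 0 := by simp [hpr, De, Pe]
  have prp : pr p = 0 := by simp [hpr, Dp, Pp]
  have D1e : D1 e = 1 := by simp [hD1, pre, De]
  have D1p : D1 p = 0 := by simp [hD1, prp, Dp]
  -- action of e on W'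
  have hP0 : ∀ w, D1 w = 0 → P w = 0 → P (m e w) = 0 := by
    intro w h1 h2
    rw [hD1, hpr, h2] at h1
    simp [hee, Pp] at h1
    exact h1
  have hψ : ∀ (ψ : Module.Dual ℂ U) w, ψ e = 0 → ψ p = 0 → D1 w = 0 → P w = 0 →
      ψ (m e w) = c * ψ w := by
    intro ψ w he hp h1 h2
    have := hc ψ (pr w) he hp (by simp [hpr, De, Dp]) (by simp [hpr, Pe, Pp])
    simp [hpr, h2, hee, hp, he] at this
    exact this
  have hew : ∀ w, D1 w = 0 → P w = 0 → m e w = c • w + D1 (m e w) • e := by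
    intro w h1 h2
    rw [← sub_eq_zero]
    refine sep2 D1e D1p Pe Pp (by simp [h1, D1e]) (by simp [h2, hP0 w h1 h2, Pe]) fun ψ he hp => ?_
    simp [hψ ψ w he hp h1 h2, he]
  let pr1 : U →ₗ[ℂ] U := LinearMap.id - D1.smulRight e - P.smulRight p
  have hpr1 : ∀ x, pr1 x = x - D1 x • e - P x • p := fun x => by simp [pr1]
  let f : Module.Dual ℂ U := c • D1 + D1 ∘ₗ (m e) ∘ₗ pr1
  have hf : ∀ x, f x = c * D1 x + D1 (m e (pr1 x)) := fun x => by simp [f]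
  have fe : f e = c := by simp [hf, hpr1, D1e, Pe]
  have fw : ∀ w, D1 w = 0 → P w = 0 → f w = D1 (m e w) := by
    intro w h1 h2; simp [hf, hpr1, h1, h2]
  apply FG_subF (f := f)
  have D2w : ∀ w, (D1 + (2 * c) • P) w = 0 → P w = 0 → D1 w = 0 := by
    intro w h1 h2; simpa [h2] using h1
  refine core2 (subF m f) (fun x y => ?_) (HH_subF H _) (D := D1 + (2 * c) • P) (P := P) (e := e)
    (p := p - (2 * c) • e) (w₀ := w₀ - P (m e w₀) • e) (ω := ω)
    (by simp [D1e, Pe]) (by simp [D1e, D1p, Pe, Pp]) Pe (by simp [Pe, Pp]) ?_ ?_ ωe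
    (by simp [ωe, ωp]) (by simp [ωe, ωw]) ?_ (by simp [Pe, Pw])
  · simp only [subF_apply, hs x y]; abel
  · simp only [subF_apply, hee, fe]; module
  · intro w h1 h2
    have h1 := D2w w h1 h2
    simp only [subF_apply, fe, fw w h1 h2]
    conv_lhs => rw [hew w h1 h2]
    simp [h1, D1e]
  · simp [D1e, Pe, Pw, hD1, hpr, Dw, De, hee, Pp]



lemma dual_one {x : U} (h : x ≠ 0) : ∃ φ : Module.Dual ℂ U, φ x = 1 := by
  have : ∃ φ : Module.Dual ℂ U, φ x ≠ 0 := by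
    by_contra hc
    push Not at hc
    exact h (sep hc)
  obtain ⟨φ, hφ⟩ := this
  exact ⟨(φ x)⁻¹ • φ, by simp [hφ]⟩

lemma dual_sep {e p : U} (h : ∀ c : ℂ, p ≠ c • e) : ∃ φ : Module.Dual ℂ U, φ e = 0 ∧ φ p = 1 := by
  by_cases he : e = 0
  · subst he
    obtain ⟨φ, hφ⟩ := dual_one (x := p) (by simpa using h 0)
    exact ⟨φ, by simp, hφ⟩
  obtain ⟨D, hD⟩ := dual_one he
  obtain ⟨φ, hφ⟩ := dual_one (x := p - D p • e) (by
    rw [sub_ne_zero]; exact h _)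
  refine ⟨φ - φ e • D, by simp [hD], ?_⟩
  simp at hφ ⊢
  linear_combination hφ

lemma ker2 [FiniteDimensional ℂ U] (hn : 3 ≤ Module.finrank ℂ U) (D P : Module.Dual ℂ U) :
    ∃ w : U, w ≠ 0 ∧ D w = 0 ∧ P w = 0 := by
  have h := LinearMap.ker_ne_bot_of_finrank_lt (f := D.prod P) (by simp; omega)
  obtain ⟨w, hw, hw0⟩ := Submodule.exists_mem_ne_zero_of_ne_bot h
  rw [LinearMap.mem_ker] at hw
  simp [Prod.ext_iff] at hw
  exact ⟨w, hw0, hw.1, hw.2⟩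

lemma HH_FG [FiniteDimensional ℂ U] (hn : 3 ≤ Module.finrank ℂ U)
    (m : U →ₗ[ℂ] U →ₗ[ℂ] U) (hs : ∀ x y, m x y = m y x) (H : HH m) : FG m := by
  by_cases hc : ∀ e, ∃ c : ℂ, m e e = c • e
  · have : Nontrivial U := Module.nontrivial_of_finrank_pos (R := ℂ) (by omega)
    obtain ⟨e, he⟩ := exists_ne (0 : U)
    obtain ⟨D, De⟩ := dual_one he
    obtain ⟨w₀, hw0, Dw, -⟩ := ker2 hn D D
    obtain ⟨ω', hω'⟩ := dual_one hw0
    have h2 : ∀ (φ : Module.Dual ℂ U) x, φ x = 0 → φ (m x x) = 0 := by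
      intro φ x hx
      obtain ⟨c, h⟩ := hc x
      simp [h, hx]
    have h3 : ∀ (φ : Module.Dual ℂ U) x y, φ x = 0 → φ y = 0 → φ (m x y) = 0 := by
      intro φ x y hx hy
      have := h2 φ (x + y) (by simp [hx, hy])
      simp [h2 φ x hx, h2 φ y hy, hs y x] at this
      exact this
    obtain ⟨c, hc1⟩ := scalar (D := D) (P := 0) (e := e) (p := 0) (m e)
      (ω := ω' - ω' e • D) (w₀ := w₀) (by simp [De]) (by simp) (by simp [hω', Dw]) Dw (by simp)
      (fun ψ w he _ _ _ hw => h3 ψ e w he hw)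
    have sepD : ∀ x, D x = 0 → (∀ ψ : Module.Dual ℂ U, ψ e = 0 → ψ x = 0) → x = 0 := by
      intro x hx h
      refine sep fun φ => ?_
      have := h (φ - φ e • D) (by simp [De])
      simpa [hx] using this
    have hew : ∀ w, D w = 0 → m e w = c • w + D (m e w) • e := by
      intro w hw
      rw [← sub_eq_zero]
      refine sepD _ (by simp [hw, De]) fun ψ hψ => ?_
      simp [hc1 ψ w hψ (by simp) hw, hψ]
    obtain ⟨c0, hc0⟩ := hc e
    have sq : ∀ w, D w = 0 → w ≠ 0 → c0 = 2 * c ∧ m w w = (2 * D (m e w)) • w := by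
      intro w hw hw0
      obtain ⟨χ, hχ⟩ := dual_one hw0
      obtain ⟨c1, hc1⟩ := hc w
      have A : ∀ t : ℂ, t ≠ 0 → 2 * c + t * c1 = c0 + 2 * t * D (m e w) := by
        intro t ht
        obtain ⟨κ, hκ⟩ := hc (e + t • w)
        have hwe : m w e = m e w := hs _ _
        have a1 := congrArg D hκ
        have a2 := congrArg (χ - χ e • D) hκ
        simp only [map_add, map_smul, LinearMap.add_apply, LinearMap.smul_apply, hwe, hc0, hc1]
          at a1 a2
        rw [hew w hw] at a2
        simp [De, hw, hχ] at a1 a2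
        apply mul_left_cancel₀ ht
        linear_combination a2 - t * a1
      have b1 := A 1 one_ne_zero
      have b2 := A (-1) (by simp)
      refine ⟨by linear_combination -(b1 + b2) / 2, ?_⟩
      rw [hc1]; congr 1
      linear_combination (b1 - b2) / 2
    have c02 := (sq w₀ Dw hw0).1
    have sq1 : ∀ w, D w = 0 → m w w = (2 * D (m e w)) • w := by
      intro w hw
      by_cases h : w = 0
      · simp [h]
      · exact (sq w hw h).2
    have sq2 : ∀ w z, D w = 0 → D z = 0 → m w z = D (m e w) • z + D (m e z) • w := by
      intro w z hw hz
      have := sq1 (w + z) (by simp [hw, hz])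
      simp only [map_add, LinearMap.add_apply, sq1 w hw, sq1 z hz, hs z w] at this
      have h : (2 : ℂ) • m w z = (2 : ℂ) • (D (m e w) • z + D (m e z) • w) := by
        linear_combination (norm := module) this
      exact smul_right_injective U (two_ne_zero (α := ℂ)) h
    let pr : U →ₗ[ℂ] U := LinearMap.id - D.smulRight e
    have hpr : ∀ x, pr x = x - D x • e := fun x => by simp [pr]
    refine ⟨c • D + D ∘ₗ (m e) ∘ₗ pr, 0, 0, fun x y => ?_⟩
    have Dp : ∀ x, D (pr x) = 0 := fun x => by simp [hpr, De]
    have dec : ∀ x, x = D x • e + pr x := fun x => by simp [hpr]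
    have r1 := hew (pr x) (Dp x)
    have r2 := hew (pr y) (Dp y)
    have r3 := sq2 (pr x) (pr y) (Dp x) (Dp y)
    have r4 := hs (pr x) e
    have hx := dec x
    have hy := dec y
    simp only [LinearMap.add_apply, LinearMap.smul_apply, LinearMap.comp_apply]
    generalize pr x = w at *
    generalize pr y = z at *
    generalize D (m e w) = a at *
    generalize D (m e z) = b at *
    generalize D x = s at *
    generalize D y = t at *
    subst hx hy
    simp only [map_add, map_smul, LinearMap.add_apply, LinearMap.smul_apply, r4, r1, r2, r3, hc0, c02,
      LinearMap.zero_apply, smul_eq_mul]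
    module
  · push Not at hc
    obtain ⟨e, he⟩ := hc
    obtain ⟨P, Pe, Pp⟩ := dual_sep he
    obtain ⟨D0, hD0⟩ := dual_one (x := e) (by
      rintro rfl
      exact he 0 (by simp))
    obtain ⟨w₀, hw0, Dw, Pw⟩ := ker2 hn (D0 - D0 (m e e) • P) P
    obtain ⟨ω, hω⟩ := dual_one hw0
    exact core1 m hs H (D := D0 - D0 (m e e) • P) (P := P) (e := e) (p := m e e)
      (by simp [hD0, Pe]) (by simp [Pp]) Pe Pp rfl (w₀ := w₀)
      (ω := ω - ω e • (D0 - D0 (m e e) • P) - ω (m e e) • P)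
      (by simp [hD0, Pe]) (by simp [Pp]) (by
        simp only [LinearMap.sub_apply, LinearMap.smul_apply] at Dw ⊢
        rw [Dw, Pw, hω]; simp) Dw Pw

/-- consequences of the Jordan identity -/
lemma jordan_FG [FiniteDimensional ℂ U] (hn : 3 ≤ Module.finrank ℂ U)
    (m : U →ₗ[ℂ] U →ₗ[ℂ] U)
    (hJ : ∀ x y, m (m x x) (m y x) = m (m (m x x) y) x) (h : FG m) :
    (∃ f : Module.Dual ℂ U, ∀ x y, m x y = f x • y + f y • x) ∨
    (∃ (g : Module.Dual ℂ U) (v : U), ∀ x y, m x y = (g x * g y) • v) ∨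
    (∃ (f : Module.Dual ℂ U) (v : U), f v = 1 ∧
      ∀ x y, m x y = f x • y + f y • x - (f x * f y) • v) := by
  obtain ⟨f, g, v, h⟩ := h
  by_cases hg : g = 0
  · left; exact ⟨f, fun x y => by simp [h, hg]⟩
  by_cases hv : v = 0
  · left; exact ⟨f, fun x y => by simp [h, hv]⟩
  by_cases hf : f = 0
  · right; left; exact ⟨g, v, fun x y => by simp [h, hf]⟩
  right; right
  obtain ⟨x0, hx0⟩ : ∃ x, g x ≠ 0 := by
    by_contra hc
    push Not at hc
    exact hg (LinearMap.ext hc)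
  let k : Module.Dual ℂ U := f + g v • g
  have hk : ∀ x, k x = f x + g v * g x := fun x => by simp [k]
  -- commutation of `L_v` with `L_x`
  have c1 : ∀ x y, g x ≠ 0 → k (m x y) • v = k y • (f v • x + k x • v) := by
    intro x y hx
    have h1 := hJ x y
    apply smul_right_injective U (pow_ne_zero 2 hx)
    simp only [h, hk, map_add, map_smul, smul_eq_mul, LinearMap.add_apply,
      LinearMap.smul_apply] at h1 ⊢
    linear_combination (norm := module) h1
  have c2 : ∀ x y, k (m x y) • v = k y • (f v • x + k x • v) := by
    intro x y
    by_cases hx : g x = 0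
    · have h1 := c1 (x + x0) y (by simpa [hx] using hx0)
      have h2 := c1 x0 y hx0
      simp only [map_add, LinearMap.add_apply] at h1
      linear_combination (norm := module) h1 - h2
    · exact c1 x y hx
  by_cases hk0 : k = 0
  · have fg : ∀ x, f x = - g v * g x := by
      intro x
      have := LinearMap.congr_fun hk0 x
      rw [hk] at this
      simp at this
      linear_combination this
    have gv : g v ≠ 0 := by
      intro h0
      apply hf
      ext x
      simp [fg, h0]
    refine ⟨f, -(g v ^ 2)⁻¹ • v, ?_, fun x y => ?_⟩
    · rw [map_smul, fg]
      simp
      field_simp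
    · rw [h]
      have : (f x * f y) • (-(g v ^ 2)⁻¹ • v) = - ((g x * g y) • v) := by
        rw [smul_smul, fg, fg, ← neg_smul]
        congr 1
        field_simp
      rw [this]; abel
  · exfalso
    obtain ⟨y0, hy0⟩ : ∃ x, k x ≠ 0 := by
      by_contra hc
      push Not at hc
      exact hk0 (LinearMap.ext hc)
    obtain ⟨χ, hχ⟩ := dual_one hv
    obtain ⟨w, hw0, hw, -⟩ := ker2 hn χ χ
    obtain ⟨ξ, hξ⟩ := dual_one hw0
    have fv : f v = 0 := by
      have := congrArg (ξ - ξ v • χ) (c2 w y0)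
      simp [hξ, hχ, hw] at this
      apply mul_left_cancel₀ hy0
      linear_combination -this
    have c3 : ∀ x y, k (m x y) = k y * k x := by
      intro x y
      have := congrArg χ (c2 x y)
      simpa [hχ, fv] using this
    apply hf
    ext x
    have := c3 x x
    simp only [h, hk, map_add, map_smul, smul_eq_mul, fv] at this
    have h2 : f x ^ 2 = 0 := by linear_combination this
    simpa using h2


end partA


section partD
variable {n : ℕ}

lemma act_apply (g : V n ≃ₗ[ℂ] V n) (μ : Bil n) (x y : V n) :
    act g μ x y = g (μ (g.symm x) (g.symm y)) := rfl

lemma act_eq_of {G : V n ≃ₗ[ℂ] V n} {l μ : Bil n} (h : ∀ x y, G (l x y) = μ (G x) (G y)) :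
    act G l = μ := by
  refine LinearMap.ext₂ fun x y => ?_
  rw [act_apply, h]; simp

lemma act_act (g h : V n ≃ₗ[ℂ] V n) (μ : Bil n) : act g (act h μ) = act (h.trans g) μ := rfl

lemma act_symm (g : V n ≃ₗ[ℂ] V n) (μ : Bil n) : act g.symm (act g μ) = μ := by
  refine LinearMap.ext₂ fun x y => ?_
  simp [act_apply]

lemma Isom.symm {l μ : Bil n} (h : Isom l μ) : Isom μ l := by
  obtain ⟨g, rfl⟩ := h
  exact ⟨g.symm, act_symm g l⟩

lemma Isom.trans {l μ ν : Bil n} (h : Isom l μ) (h' : Isom μ ν) : Isom l ν := by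
  obtain ⟨g, rfl⟩ := h
  obtain ⟨k, rfl⟩ := h'
  exact ⟨g.trans k, rfl⟩

lemma mem_orb {l μ : Bil n} : μ ∈ orb l ↔ Isom l μ := Iff.rfl

lemma Isom.orb_eq {l μ : Bil n} (h : Isom l μ) : orb l = orb μ := by
  ext ν
  simp only [mem_orb]
  exact ⟨fun h' => h.symm.trans h', fun h' => h.trans h'⟩

lemma levelTwo_iff_of_isom {l μ : Bil n} (h : Isom l μ) : levelTwo l ↔ levelTwo μ := by
  unfold levelTwo
  rw [h.orb_eq]

/-- splitting along a map with a section -/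
def splitE {A : Type*} [AddCommGroup A] [Module ℂ A] (F : V n →ₗ[ℂ] A) (s : A →ₗ[ℂ] V n)
    (h : ∀ a, F (s a) = a) : V n ≃ₗ[ℂ] A × LinearMap.ker F where
  toFun x := (F x, ⟨x - s (F x), by simp [h]⟩)
  map_add' x y := by
    ext1
    · simp
    · ext1; simp; abel
  map_smul' c x := by
    ext1
    · simp
    · ext1; simp [smul_sub]
  invFun z := s z.1 + z.2
  left_inv x := by simp
  right_inv z := by
    obtain ⟨a, k, hk⟩ := z
    rw [LinearMap.mem_ker] at hk
    simp [h, hk]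

lemma exists_GL {A : Type*} [AddCommGroup A] [Module ℂ A] [FiniteDimensional ℂ A]
    (F F' : V n →ₗ[ℂ] A) (s s' : A →ₗ[ℂ] V n)
    (h : ∀ a, F (s a) = a) (h' : ∀ a, F' (s' a) = a) :
    ∃ G : V n ≃ₗ[ℂ] V n, (∀ x, F' (G x) = F x) ∧ ∀ a, G (s a) = s' a := by
  have e1 := (splitE F s h).finrank_eq
  have e2 := (splitE F' s' h').finrank_eq
  rw [Module.finrank_prod] at e1 e2
  let k : LinearMap.ker F ≃ₗ[ℂ] LinearMap.ker F' := LinearEquiv.ofFinrankEq _ _ (by omega)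
  refine ⟨(splitE F s h).trans (((LinearEquiv.refl ℂ A).prodCongr k).trans (splitE F' s' h').symm),
    fun x => ?_, fun a => ?_⟩
  · have : F' ((k (splitE F s h x).2 : V n)) = 0 := (k (splitE F s h x).2).2
    simp only [splitE, LinearEquiv.coe_mk, LinearMap.coe_mk, AddHom.coe_mk] at this
    simp [splitE, h', this]
  · have : (splitE F s h (s a)) = (a, 0) := by
      simp [splitE, h]
    simp [this]
    simp [splitE]

lemma iso_R1 {l l' : Bil n} {g g' : Module.Dual ℂ (V n)} {v v' : V n}
    (h : ∀ x y, l x y = (g x * g y) • v) (h' : ∀ x y, l' x y = (g' x * g' y) • v')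
    (gv : g v = 1) (gv' : g' v' = 1) : Isom l l' := by
  obtain ⟨G, h1, h2⟩ := exists_GL g g' (LinearMap.toSpanSingleton ℂ _ v)
    (LinearMap.toSpanSingleton ℂ _ v') (by simp [gv]) (by simp [gv'])
  refine ⟨G, act_eq_of fun x y => ?_⟩
  have := h2 1
  simp at this
  rw [h, h', map_smul, this, h1, h1]

lemma iso_F2 {l l' : Bil n} {g g' : Module.Dual ℂ (V n)} {v v' : V n}
    (h : ∀ x y, l x y = g x • y + g y • x - (g x * g y) • v)
    (h' : ∀ x y, l' x y = g' x • y + g' y • x - (g' x * g' y) • v')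
    (gv : g v = 1) (gv' : g' v' = 1) : Isom l l' := by
  obtain ⟨G, h1, h2⟩ := exists_GL g g' (LinearMap.toSpanSingleton ℂ _ v)
    (LinearMap.toSpanSingleton ℂ _ v') (by simp [gv]) (by simp [gv'])
  refine ⟨G, act_eq_of fun x y => ?_⟩
  have := h2 1
  simp at this
  simp only [h, h', map_sub, map_add, map_smul, this, h1]

lemma iso_nu {l l' : Bil n} {g g' : Module.Dual ℂ (V n)}
    (h : ∀ x y, l x y = g x • y + g y • x)
    (h' : ∀ x y, l' x y = g' x • y + g' y • x)
    (gv : g ≠ 0) (gv' : g' ≠ 0) : Isom l l' := by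
  have ex : ∀ g : Module.Dual ℂ (V n), g ≠ 0 → ∃ u, g u = 1 := by
    intro g hg
    obtain ⟨u, hu⟩ := LinearMap.surjective hg 1
    exact ⟨u, hu⟩
  obtain ⟨v, gv⟩ := ex g gv
  obtain ⟨v', gv'⟩ := ex g' gv'
  obtain ⟨G, h1, h2⟩ := exists_GL g g' (LinearMap.toSpanSingleton ℂ _ v)
    (LinearMap.toSpanSingleton ℂ _ v') (by simp [gv]) (by simp [gv'])
  refine ⟨G, act_eq_of fun x y => ?_⟩
  simp only [h, h', map_add, map_smul, h1]

lemma iso_nil {l l' : Bil n} {g g' : Module.Dual ℂ (V n)} {v v' : V n}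
    (h : ∀ x y, l x y = (g x * g y) • v) (h' : ∀ x y, l' x y = (g' x * g' y) • v')
    (gv : g v = 0) (gv' : g' v' = 0) (hg : g ≠ 0) (hg' : g' ≠ 0) (hv : v ≠ 0) (hv' : v' ≠ 0) :
    Isom l l' := by
  have ex : ∀ (g : Module.Dual ℂ (V n)) (v : V n), g ≠ 0 → v ≠ 0 → g v = 0 →
      ∃ (u : V n) (k : Module.Dual ℂ (V n)), g u = 1 ∧ k u = 0 ∧ k v = 1 := by
    intro g v hg hv gv
    obtain ⟨u, hu⟩ := LinearMap.surjective hg 1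
    obtain ⟨k, hk⟩ := dual_one hv
    exact ⟨u, k - k u • g, hu, by simp [hu], by simp [hk, gv]⟩
  obtain ⟨u, k, a1, a2, a3⟩ := ex g v hg hv gv
  obtain ⟨u', k', b1, b2, b3⟩ := ex g' v' hg' hv' gv'
  obtain ⟨G, h1, h2⟩ := exists_GL (g.prod k) (g'.prod k')
    ((LinearMap.toSpanSingleton ℂ _ u).coprod (LinearMap.toSpanSingleton ℂ _ v))
    ((LinearMap.toSpanSingleton ℂ _ u').coprod (LinearMap.toSpanSingleton ℂ _ v'))
    (by simp [gv, a1, a2, a3]) (by simp [gv', b1, b2, b3])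
  refine ⟨G, act_eq_of fun x y => ?_⟩
  have h3 := h2 (0, 1)
  have h4 : ∀ x, g' (G x) = g x := fun x => congrArg Prod.fst (h1 x)
  simp at h3
  simp only [h, h', map_smul, h3, h4]

lemma iso_3 {l l' : Bil n} {g h k g' h' k' : Module.Dual ℂ (V n)} {u w v u' w' v' : V n}
    (H : ∀ x y, l x y = (g x * h y + h x * g y) • v)
    (H' : ∀ x y, l' x y = (g' x * h' y + h' x * g' y) • v')
    (a : g u = 1 ∧ g w = 0 ∧ g v = 0 ∧ h u = 0 ∧ h w = 1 ∧ h v = 0 ∧ k u = 0 ∧ k w = 0 ∧ k v = 1)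
    (a' : g' u' = 1 ∧ g' w' = 0 ∧ g' v' = 0 ∧ h' u' = 0 ∧ h' w' = 1 ∧ h' v' = 0 ∧
      k' u' = 0 ∧ k' w' = 0 ∧ k' v' = 1) : Isom l l' := by
  obtain ⟨a1, a2, a3, a4, a5, a6, a7, a8, a9⟩ := a
  obtain ⟨b1, b2, b3, b4, b5, b6, b7, b8, b9⟩ := a'
  obtain ⟨G, h1, h2⟩ := exists_GL (g.prod (h.prod k)) (g'.prod (h'.prod k'))
    ((LinearMap.toSpanSingleton ℂ _ u).coprod
      ((LinearMap.toSpanSingleton ℂ _ w).coprod (LinearMap.toSpanSingleton ℂ _ v)))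
    ((LinearMap.toSpanSingleton ℂ _ u').coprod
      ((LinearMap.toSpanSingleton ℂ _ w').coprod (LinearMap.toSpanSingleton ℂ _ v')))
    (by simp [a1, a2, a3, a4, a5, a6, a7, a8, a9]) (by simp [b1, b2, b3, b4, b5, b6, b7, b8, b9])
  refine ⟨G, act_eq_of fun x y => ?_⟩
  have h3 := h2 (0, 0, 1)
  have h4 : ∀ x, g' (G x) = g x := fun x => congrArg Prod.fst (h1 x)
  have h5 : ∀ x, h' (G x) = h x := fun x => congrArg (fun z => z.2.1) (h1 x)
  simp at h3
  simp only [H, H', map_smul, h3, h4, h5]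

/-! formulas for the tables -/

lemma E_apply (k : ℕ) (m : Fin n) : E n k m = if (m : ℕ) = k then 1 else 0 := rfl

lemma ofTable_apply (c : Fin n → Fin n → V n) (x y : V n) :
    ofTable c x y = ∑ i : Fin n, ∑ j : Fin n, (x i * y j) • c i j := rfl

/-- coordinate functional -/
def pj (i : Fin n) : Module.Dual ℂ (V n) := LinearMap.proj i

lemma pj_apply (i : Fin n) (x : V n) : pj i x = x i := rfl

lemma J1_apply (h : 0 < n) (x y : V n) :
    J1 n x y = (pj ⟨0, h⟩ x * pj ⟨0, h⟩ y) • E n 0 := by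
  have e : ∀ i : Fin n, i.val = 0 ↔ i = ⟨0, h⟩ := fun i => by simp [Fin.ext_iff]
  rw [J1, ofTable_apply]
  simp only [e, ite_and, pj_apply]
  simp

lemma J2_apply (h : 0 < n) (x y : V n) :
    J2 n x y = pj ⟨0, h⟩ x • y + pj ⟨0, h⟩ y • x - (pj ⟨0, h⟩ x * pj ⟨0, h⟩ y) • E n 0 := by
  have e : ∀ i : Fin n, i.val = 0 ↔ i = ⟨0, h⟩ := fun i => by simp [Fin.ext_iff]
  have t : ∀ i j : Fin n, (if i.val = 0 then E n j.val else if j.val = 0 then E n i.val else 0) =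
      (if i = ⟨0, h⟩ then E n j.val else 0) + (if j = ⟨0, h⟩ then E n i.val else 0) -
      (if i = ⟨0, h⟩ then if j = ⟨0, h⟩ then E n 0 else 0 else 0) := by
    intro i j
    simp only [e]
    split_ifs with h1 h2 <;> simp_all
  rw [J2, ofTable_apply]
  simp only [t, smul_sub, smul_add, Finset.sum_add_distrib, Finset.sum_sub_distrib]
  ext m
  simp [pj_apply, E_apply, Fin.val_inj, Finset.sum_comm (γ := Fin n), mul_comm]

lemma J3_apply (h : 3 ≤ n) (x y : V n) :
    J3 n x y = (pj ⟨0, by omega⟩ x * pj ⟨1, by omega⟩ y + pj ⟨1, by omega⟩ x * pj ⟨0, by omega⟩ y)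
      • E n 2 := by
  have t : ∀ i j : Fin n, (if (i.val = 0 ∧ j.val = 1) ∨ (i.val = 1 ∧ j.val = 0) then E n 2 else 0) =
      (if i = ⟨0, by omega⟩ then if j = ⟨1, by omega⟩ then E n 2 else 0 else 0) +
      (if i = ⟨1, by omega⟩ then if j = ⟨0, by omega⟩ then E n 2 else 0 else 0) := by
    intro i j
    simp only [Fin.ext_iff]
    split_ifs <;> first | omega | simp
  rw [J3, ofTable_apply]
  simp only [t, smul_add, Finset.sum_add_distrib, add_smul, pj_apply]
  simp

end partD


section partT
variable {n : ℕ}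

lemma closed_all {X A : Type*} [TopologicalSpace X] {p : A → X → Prop}
    (h : ∀ a, IsClosed {x | p a x}) : IsClosed {x | ∀ a, p a x} := by
  simp only [Set.ofPred_forall]
  exact isClosed_iInter h

lemma cont_eval (x y : V n) : Continuous fun μ : Bil n => μ x y := by
  have h : Continuous (fun μ : Bil n => fun x y : V n => μ x y) := continuous_induced_dom
  exact (continuous_apply y).comp ((continuous_apply x).comp h)

lemma cont_eval' (x y : V n) (i : Fin n) : Continuous fun μ : Bil n => μ x y i :=
  (continuous_apply i).comp (cont_eval x y)

lemma cont_to {X : Type*} [TopologicalSpace X] {f : X → Bil n}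
    (h : ∀ x y, Continuous fun t => f t x y) : Continuous f :=
  continuous_induced_rng.2 (continuous_pi fun x => continuous_pi fun y => h x y)

/-- degeneration by a grading -/
lemma degen (l : Bil n) (p q r : V n →ₗ[ℂ] V n)
    (hpp : ∀ x, p (p x) = p x) (hqq : ∀ x, q (q x) = q x) (hrr : ∀ x, r (r x) = r x)
    (hpq : ∀ x, p (q x) = 0) (hqp : ∀ x, q (p x) = 0) (hpr : ∀ x, p (r x) = 0)
    (hrp : ∀ x, r (p x) = 0) (hqr : ∀ x, q (r x) = 0) (hrq : ∀ x, r (q x) = 0)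
    (h1 : ∀ x, p x + q x + r x = x) (μ : Bil n) (hμ : ∀ x y, μ x y = r (l (p x) (p y))) :
    μ ∈ closure (orb l) := by
  let B : ℂ → V n →ₗ[ℂ] V n := fun s => p + s • q + s ^ 2 • r
  let C : ℂ → V n →ₗ[ℂ] V n := fun s => s ^ 2 • p + s • q + r
  let f : ℂ → Bil n := fun s => (l.compl₁₂ (B s) (B s)).compr₂ (C s)
  have hf : ∀ s x y, f s x y = C s (l (B s x) (B s y)) := fun s x y => rfl
  have hc : Continuous f := by
    refine cont_to fun x y => ?_
    simp only [hf, B, C, LinearMap.add_apply, LinearMap.smul_apply, map_add, map_smul]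
    fun_prop
  have h0 : f 0 = μ := by
    refine LinearMap.ext₂ fun x y => ?_
    simp [hf, B, C, hμ]
  have hs : ∀ s : ℂ, s ≠ 0 → f s ∈ orb l := by
    intro s hs
    have hCB : ∀ x, C s (B s x) = s ^ 2 • x := by
      intro x
      simp only [B, C, LinearMap.add_apply, LinearMap.smul_apply, map_add, map_smul, hpp, hqq, hrr,
        hpq, hqp, hpr, hrp, hqr, hrq]
      conv_rhs => rw [← h1 x]
      module
    have hBC : ∀ x, B s (C s x) = s ^ 2 • x := by
      intro x
      simp only [B, C, LinearMap.add_apply, LinearMap.smul_apply, map_add, map_smul, hpp, hqq, hrr,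
        hpq, hqp, hpr, hrp, hqr, hrq]
      conv_rhs => rw [← h1 x]
      module
    have s2 : (s ^ 4)⁻¹ * (s ^ 2 * s ^ 2) = 1 := by field_simp
    let G : V n ≃ₗ[ℂ] V n := LinearEquiv.ofLinearMap ((s ^ 4)⁻¹ • C s) (s ^ 2 • B s)
      (by
        refine LinearMap.ext fun x => ?_
        simp only [LinearMap.comp_apply, LinearMap.smul_apply, map_smul, hCB, smul_smul,
          LinearMap.id_apply]
        convert one_smul ℂ x using 2
        linear_combination s2)
      (by
        refine LinearMap.ext fun x => ?_
        simp only [LinearMap.comp_apply, LinearMap.smul_apply, map_smul, hBC, smul_smul,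
          LinearMap.id_apply]
        convert one_smul ℂ x using 2)
    refine ⟨G, LinearMap.ext₂ fun x y => ?_⟩
    have a1 : ∀ z, G z = (s ^ 4)⁻¹ • C s z := fun z => rfl
    have a2 : ∀ z, G.symm z = s ^ 2 • B s z := fun z => rfl
    change act G l x y = f s x y
    rw [act_apply, hf, a1, a2, a2]
    simp only [map_smul, LinearMap.smul_apply, smul_smul]
    rw [s2, one_smul]
  have : Filter.Tendsto f (nhdsWithin 0 {0}ᶜ) (nhds μ) := by
    rw [← h0]
    exact hc.continuousAt.tendsto.mono_left nhdsWithin_le_nhds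
  refine mem_closure_of_tendsto this ?_
  filter_upwards [self_mem_nhdsWithin] with s hs'
  exact hs s hs'

/-- degeneration to the square-zero-type algebra -/
lemma degen2 (l : Bil n) (D P : Module.Dual ℂ (V n)) (e p : V n) (De : D e = 1) (Dp : D p = 0)
    (Pe : P e = 0) (Pp : P p = 1) (hP : P (l e e) ≠ 0) :
    ∃ μ ∈ closure (orb l), ∃ (g : Module.Dual ℂ (V n)) (v : V n), g v = 0 ∧ g ≠ 0 ∧ v ≠ 0 ∧
      ∀ x y, μ x y = (g x * g y) • v := by
  let a : V n →ₗ[ℂ] V n := D.smulRight e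
  let r : V n →ₗ[ℂ] V n := P.smulRight p
  have ha : ∀ x, a x = D x • e := fun x => rfl
  have hr : ∀ x, r x = P x • p := fun x => rfl
  refine ⟨(l.compl₁₂ a a).compr₂ r, ?_, D, P (l e e) • p, by simp [Dp], ?_, ?_, ?_⟩
  · refine degen l a (LinearMap.id - a - r) r ?_ ?_ ?_ ?_ ?_ ?_ ?_ ?_ ?_ ?_ _ (fun x y => rfl) <;>
      intro x <;> simp [ha, hr, De, Dp, Pe, Pp] <;> abel
  · rintro rfl; simp at De
  · intro h
    rcases smul_eq_zero.1 h with h | h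
    · exact hP h
    · rw [h] at Pp; simp at Pp
  · intro x y
    simp only [LinearMap.compr₂_apply, LinearMap.compl₁₂_apply, ha, hr, map_smul,
      LinearMap.smul_apply, smul_smul, smul_eq_mul]
    congr 1; ring

def R1 (μ : Bil n) : Prop :=
  ∃ (g : Module.Dual ℂ (V n)) (v : V n), ∀ x y, μ x y = (g x * g y) • v

lemma sym_nz {μ : Bil n} (hs : ∀ x y, μ x y = μ y x) (h : μ ≠ 0) : ∃ x i, μ x x i ≠ 0 := by
  by_contra hc
  push Not at hc
  apply h
  refine LinearMap.ext₂ fun x y => ?_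
  ext i
  have := hc (x + y) i
  simp [hc x i, hc y i, hs y x] at this
  simpa using this

lemma R1_iff (μ : Bil n) : R1 μ ↔ ((∀ x y, μ x y = μ y x) ∧
    (∀ x y z w i j, μ x y i * μ z w j = μ x y j * μ z w i) ∧
    (∀ x y z w i j, μ x y i * μ z w j = μ x z i * μ y w j)) := by
  constructor
  · rintro ⟨g, v, h⟩
    refine ⟨fun x y => by rw [h, h, mul_comm], fun x y z w i j => ?_, fun x y z w i j => ?_⟩
    · simp [h]; ring
    · simp [h]; ring
  · rintro ⟨hs, h1, h2⟩
    by_cases h0 : μ = 0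
    · exact ⟨0, 0, by simp [h0]⟩
    obtain ⟨x0, i0, hx⟩ := sym_nz hs h0
    refine ⟨pj i0 ∘ₗ μ x0, ((μ x0 x0 i0) ^ 2)⁻¹ • μ x0 x0, fun z w => ?_⟩
    ext j
    have a1 := h2 x0 x0 z w i0 j
    have a2 := h1 x0 w x0 x0 i0 j
    simp only [LinearMap.comp_apply, pj_apply, Pi.smul_apply, smul_eq_mul]
    field_simp
    linear_combination μ x0 x0 i0 * a1 - μ x0 z i0 * a2

lemma R1_closed : IsClosed {μ : Bil n | R1 μ} := by
  have : {μ : Bil n | R1 μ} = {μ : Bil n | ∀ x y, μ x y = μ y x} ∩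
      ({μ : Bil n | ∀ x y z w i j, μ x y i * μ z w j = μ x y j * μ z w i} ∩
      {μ : Bil n | ∀ x y z w i j, μ x y i * μ z w j = μ x z i * μ y w j}) :=
    Set.ext fun μ => R1_iff μ
  rw [this]
  refine IsClosed.inter ?_ (IsClosed.inter ?_ ?_)
  · exact closed_all fun x => closed_all fun y => isClosed_eq (cont_eval x y) (cont_eval y x)
  all_goals
    refine closed_all fun x => closed_all fun y => closed_all fun z => closed_all fun w =>
      closed_all fun i => closed_all fun j => ?_
    exact isClosed_eq ((cont_eval' _ _ _).mul (cont_eval' _ _ _))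
      ((cont_eval' _ _ _).mul (cont_eval' _ _ _))

lemma act_R1 {μ : Bil n} (h : R1 μ) (G : V n ≃ₗ[ℂ] V n) : R1 (act G μ) := by
  obtain ⟨g, v, h⟩ := h
  exact ⟨g ∘ₗ G.symm.toLinearMap, G v, fun x y => by simp [act_apply, h]⟩

/-- trace of left multiplication -/
def tr (μ : Bil n) : Module.Dual ℂ (V n) := (LinearMap.trace ℂ (V n)) ∘ₗ μ

lemma tr_apply (μ : Bil n) (x : V n) : tr μ x = ∑ i, μ x (Pi.single i 1) i := by
  simp only [tr, LinearMap.comp_apply]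
  rw [LinearMap.trace_eq_matrix_trace ℂ (Pi.basisFun ℂ (Fin n))]
  simp [Matrix.trace, LinearMap.toMatrix_apply]

lemma cont_tr (x : V n) : Continuous fun μ : Bil n => tr μ x := by
  simp only [tr_apply]
  exact continuous_finsetSum _ fun i _ => cont_eval' _ _ _

lemma tr_act (μ : Bil n) (G : V n ≃ₗ[ℂ] V n) (x : V n) : tr (act G μ) x = tr μ (G.symm x) := by
  have : act G μ x = G.conj (μ (G.symm x)) := by
    ext y; simp [act_apply, LinearEquiv.conj_apply]
  simp only [tr, LinearMap.comp_apply, this]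
  exact LinearMap.trace_conj' _ _

lemma tr_R1 {μ : Bil n} {g : Module.Dual ℂ (V n)} {v : V n} (h : ∀ x y, μ x y = (g x * g y) • v)
    (x : V n) : tr μ x = g x * g v := by
  have : μ x = g x • g.smulRight v := by
    ext1; ext1; simp [h, smul_smul]
  simp only [tr, LinearMap.comp_apply, this, map_smul, LinearMap.trace_smulRight, smul_eq_mul]

/-- nil-type multiplications have level at most one -/
lemma nil_level {μ : Bil n} {g : Module.Dual ℂ (V n)} {v : V n} (h : ∀ x y, μ x y = (g x * g y) • v)
    (gv : g v = 0) : closure (orb μ) ⊆ orb μ ∪ {0} := by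
  have hcl : closure (orb μ) ⊆ {ν | R1 ν} ∩ {ν | ∀ x, tr ν x = 0} := by
    refine closure_minimal ?_ (R1_closed.inter ?_)
    · rintro _ ⟨G, rfl⟩
      refine ⟨act_R1 ⟨g, v, h⟩ G, fun x => ?_⟩
      rw [tr_act, tr_R1 h, gv, mul_zero]
    · exact closed_all fun x => isClosed_eq (cont_tr x) continuous_const
  by_cases hμ : μ = 0
  · subst hμ
    have : orb (0 : Bil n) ⊆ {0} := by
      rintro _ ⟨G, rfl⟩
      refine LinearMap.ext₂ fun x y => ?_
      simp [act_apply]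
    refine (closure_minimal (t := {ν : Bil n | ∀ x y, ν x y = 0}) ?_ ?_).trans ?_
    · intro ν hν
      have := this hν
      simp at this
      simp [this]
    · exact closed_all fun x => closed_all fun y =>
        isClosed_eq (cont_eval x y) continuous_const
    · intro ν hν
      right
      exact LinearMap.ext₂ hν
  intro ν hν
  obtain ⟨⟨g', v', h'⟩, ht⟩ := hcl hν
  by_cases hg' : g' = 0
  · right; exact LinearMap.ext₂ fun x y => by simp [h', hg']
  by_cases hv' : v' = 0
  · right; exact LinearMap.ext₂ fun x y => by simp [h', hv']
  left
  have gv' : g' v' = 0 := by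
    obtain ⟨u, hu⟩ := LinearMap.surjective hg' 1
    have := ht u
    rwa [tr_R1 h', hu, one_mul] at this
  refine iso_nil h h' gv gv' ?_ hg' ?_ hv'
  · rintro rfl; exact hμ (LinearMap.ext₂ fun x y => by simp [h])
  · rintro rfl; exact hμ (LinearMap.ext₂ fun x y => by simp [h])

end partT


section partZ
variable {n : ℕ}

lemma lvl_J1 (hn : 3 ≤ n) : levelTwo (J1 n) := by
  have h0 : 0 < n := by omega
  have hJ := J1_apply h0
  have p0 : pj ⟨0, h0⟩ (E n 0) = 1 := by simp [pj_apply, E_apply]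
  have hR : R1 (J1 n) := ⟨_, _, hJ⟩
  have hcl : closure (orb (J1 n)) ⊆ {ν | R1 ν} := by
    refine closure_minimal ?_ R1_closed
    rintro _ ⟨G, rfl⟩
    exact act_R1 hR G
  constructor
  · rintro μ ⟨hμ, hμ'⟩
    obtain ⟨g, v, h⟩ := hcl hμ
    by_cases gv : g v = 0
    · exact nil_level h gv
    · exfalso
      apply hμ'
      refine iso_R1 (g' := g v • g) (v' := (g v ^ 2)⁻¹ • v) hJ (fun x y => ?_) p0 ?_
      · rw [h, smul_smul]
        congr 1
        simp; field_simp
      · simp; field_simp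
  · obtain ⟨μ, hμ, g, v, gv, hg, hv, h⟩ := degen2 (J1 n) (pj ⟨1, by omega⟩)
      (pj ⟨0, h0⟩ - pj ⟨1, by omega⟩) (E n 0 + E n 1) (E n 0)
      (by simp [pj_apply, E_apply]) (by simp [pj_apply, E_apply]) (by simp [pj_apply, E_apply])
      (by simp [pj_apply, E_apply]) (by simp [hJ, pj_apply, E_apply])
    refine ⟨μ, ⟨hμ, ?_⟩, ?_⟩
    · rintro ⟨G, rfl⟩
      have h1 := tr_R1 h (G (E n 0))
      rw [tr_act, tr_R1 hJ, gv, mul_zero] at h1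
      simp [p0] at h1
    · rintro rfl
      obtain ⟨u, hu⟩ := LinearMap.surjective hg 1
      have := h u u
      simp [hu] at this
      exact hv this.symm

lemma tr_nu (f : Module.Dual ℂ (V n)) (x : V n) :
    LinearMap.trace ℂ (V n) (f x • LinearMap.id + f.smulRight x) = n * f x + f x := by
  simp [LinearMap.trace_smulRight, mul_comm]

lemma tr_F2 {l : Bil n} {f : Module.Dual ℂ (V n)} {v : V n}
    (h : ∀ x y, l x y = f x • y + f y • x - (f x * f y) • v) (fv : f v = 1) (x : V n) :
    tr l x = n * f x := by
  have : l x = (f x • LinearMap.id + f.smulRight x) - f x • f.smulRight v := by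
    ext1; ext1; simp [h, smul_smul]
  simp only [tr, LinearMap.comp_apply, this, map_sub, tr_nu, map_smul, LinearMap.trace_smulRight,
    fv, smul_eq_mul]
  ring

/-- the deviation from being of `ν` type -/
def dev (c : ℂ) (μ : Bil n) : Bil n := - subF μ (c • tr μ)

lemma dev_apply (c : ℂ) (μ : Bil n) (x y : V n) :
    dev c μ x y = (c * tr μ x) • y + (c * tr μ y) • x - μ x y := by
  simp [dev, subF_apply]; abel

lemma cont_dev (c : ℂ) : Continuous (dev c : Bil n → Bil n) := by
  refine cont_to fun x y => ?_
  simp only [dev_apply]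
  exact (((continuous_const.mul (cont_tr x)).smul continuous_const).add
    ((continuous_const.mul (cont_tr y)).smul continuous_const)).sub (cont_eval x y)

lemma lvl_J2 (hn : 3 ≤ n) : levelTwo (J2 n) := by
  have h0 : 0 < n := by omega
  have hn0 : (n : ℂ) ≠ 0 := by exact_mod_cast h0.ne'
  have hJ := J2_apply h0
  have p0 : pj ⟨0, h0⟩ (E n 0) = 1 := by simp [pj_apply, E_apply]
  have hcl : closure (orb (J2 n)) ⊆ (dev (n : ℂ)⁻¹) ⁻¹' {ν | R1 ν} ∩
      {μ | ∀ x, tr (dev (n : ℂ)⁻¹ μ) x = (n : ℂ)⁻¹ * tr μ x} := by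
    refine closure_minimal ?_ ((R1_closed.preimage (cont_dev _)).inter
      (closed_all fun x => isClosed_eq ((cont_tr x).comp (cont_dev _))
        (continuous_const.mul (cont_tr x))))
    rintro _ ⟨G, rfl⟩
    set f : Module.Dual ℂ (V n) := pj ⟨0, h0⟩ ∘ₗ G.symm.toLinearMap with hf
    have h1 : ∀ x y, act G (J2 n) x y = f x • y + f y • x - (f x * f y) • G (E n 0) := by
      intro x y
      simp [act_apply, hJ, hf]
    have fv : f (G (E n 0)) = 1 := by simp [hf, p0]
    have h2 := tr_F2 h1 fv
    have h3 : ∀ x y, dev (n : ℂ)⁻¹ (act G (J2 n)) x y = (f x * f y) • G (E n 0) := by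
      intro x y
      rw [dev_apply, h2, h2, h1, inv_mul_cancel_left₀ hn0, inv_mul_cancel_left₀ hn0]
      abel
    refine ⟨⟨_, _, h3⟩, fun x => ?_⟩
    change tr (dev (n : ℂ)⁻¹ (act G (J2 n))) x = (n : ℂ)⁻¹ * tr (act G (J2 n)) x
    rw [tr_R1 h3, fv, h2, inv_mul_cancel_left₀ hn0, mul_one]
  constructor
  · rintro μ ⟨hμ, hμ'⟩
    obtain ⟨⟨g, w, h⟩, ht⟩ := hcl hμ
    have ht : ∀ x, (n : ℂ)⁻¹ * tr μ x = g x * g w := fun x => by rw [← tr_R1 h, ht x]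
    have hm : ∀ x y, μ x y = (g x * g w) • y + (g y * g w) • x - (g x * g y) • w := by
      intro x y
      have := h x y
      rw [dev_apply, ht, ht] at this
      rw [← this]; abel
    by_cases gv : g w = 0
    · exact nil_level (g := g) (v := -w) (fun x y => by simp [hm, gv]) (by simp [gv])
    · exfalso
      apply hμ'
      refine iso_F2 (g' := g w • g) (v' := (g w ^ 2)⁻¹ • w) hJ (fun x y => ?_) p0 ?_
      · rw [hm, smul_smul]
        congr 2
        · simp [mul_comm]
        · simp [mul_comm]
        · simp; field_simp
      · simp; field_simp
  · obtain ⟨μ, hμ, g, v, gv, hg, hv, h⟩ := degen2 (J2 n) (pj ⟨1, by omega⟩)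
      (pj ⟨0, h0⟩ - pj ⟨1, by omega⟩) (E n 0 + E n 1) (E n 0)
      (by simp [pj_apply, E_apply]) (by simp [pj_apply, E_apply]) (by simp [pj_apply, E_apply])
      (by simp [pj_apply, E_apply]) (by simp [hJ, pj_apply, E_apply])
    refine ⟨μ, ⟨hμ, ?_⟩, ?_⟩
    · rintro ⟨G, rfl⟩
      have h1 := tr_R1 h (G (E n 0))
      rw [tr_act, gv, mul_zero] at h1
      simp [tr_F2 hJ p0, p0] at h1
      omega
    · rintro rfl
      obtain ⟨u, hu⟩ := LinearMap.surjective hg 1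
      have := h u u
      simp [hu] at this
      exact hv this.symm

lemma nu_not {l : Bil n} {f : Module.Dual ℂ (V n)}
    (h : ∀ x y, l x y = f x • y + f y • x) : closure (orb l) ⊆ orb l ∪ {0} := by
  have hn0 : (n : ℂ) + 1 ≠ 0 := by exact_mod_cast Nat.succ_ne_zero n
  have hcl : closure (orb l) ⊆ {μ | ∀ x y, dev ((n : ℂ) + 1)⁻¹ μ x y = 0} := by
    refine closure_minimal ?_ (closed_all fun x => closed_all fun y =>
      isClosed_eq ((cont_eval x y).comp (cont_dev _)) continuous_const)
    rintro _ ⟨G, rfl⟩ x y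
    change dev ((n : ℂ) + 1)⁻¹ (act G l) x y = 0
    have ht : ∀ x, tr l x = (n + 1) * f x := by
      intro x
      have : l x = (f x • LinearMap.id + f.smulRight x) := by
        ext1; ext1; simp [h]
      simp only [tr, LinearMap.comp_apply, this, tr_nu]
      ring
    rw [dev_apply, tr_act, tr_act, ht, ht, inv_mul_cancel_left₀ hn0, inv_mul_cancel_left₀ hn0,
      act_apply, h]
    simp
  intro μ hμ
  have h' : ∀ x y, μ x y = ((((n : ℂ) + 1)⁻¹ • tr μ) x) • y + ((((n : ℂ) + 1)⁻¹ • tr μ) y) • x := by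
    intro x y
    have := hcl hμ x y
    rw [dev_apply, sub_eq_zero] at this
    rw [← this]; simp
  by_cases hf' : (((n : ℂ) + 1)⁻¹ • tr μ) = 0
  · right
    refine LinearMap.ext₂ fun x y => ?_
    rw [h', hf']; simp
  left
  by_cases hf : f = 0
  · exfalso
    apply hf'
    have hl : ∀ x y, l x y = ((0 : Module.Dual ℂ (V n)) x * (0 : Module.Dual ℂ (V n)) y) • (0 : V n) := by
      intro x y; simp [h, hf]
    have hl0 : l = 0 := LinearMap.ext₂ fun x y => by simp [h, hf]
    have := nil_level hl (by simp) hμ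
    have hμ0 : μ = 0 := by
      rcases this with ⟨G, rfl⟩ | h
      · refine LinearMap.ext₂ fun x y => ?_
        simp [act_apply, hl0]
      · exact h
    rw [hμ0]
    simp [tr]
  exact iso_nu h h' hf hf'

end partZ


section partY
variable {n : ℕ}

lemma isoJ3 (hn : 3 ≤ n) {l : Bil n} {g h : Module.Dual ℂ (V n)} {u w v : V n}
    (H : ∀ x y, l x y = (g x * h y + h x * g y) • v)
    (a1 : g u = 1) (a2 : g w = 0) (a3 : g v = 0) (a4 : h u = 0) (a5 : h w = 1) (a6 : h v = 0)
    (hv : v ≠ 0) : Isom l (J3 n) := by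
  obtain ⟨k, hk⟩ := dual_one hv
  refine iso_3 (k := k - k u • g - k w • h) (u := u) (w := w) (k' := pj ⟨2, by omega⟩)
    (u' := E n 0) (w' := E n 1) H (J3_apply hn)
    ⟨a1, a2, a3, a4, a5, a6, by simp [a1, a4], by simp [a2, a5], by simp [a3, a6, hk]⟩ ?_
  simp [pj_apply, E_apply]

lemma expand (μ : Bil n) (a z : V n) : μ a z = ∑ i, a i • μ (Pi.single i 1) z := by
  conv_lhs => rw [← Finset.univ_sum_single a]
  have : ∀ i, Pi.single i (a i) = a i • (Pi.single i 1 : V n) := by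
    intro i; rw [← Pi.single_smul]; simp
  simp [this]

/-- closed conditions satisfied by `J₃` -/
def C3 (μ : Bil n) : Prop :=
  (∀ x y, μ x y = μ y x) ∧
  (∀ x y z w i j, μ x y i * μ z w j = μ x y j * μ z w i) ∧
  (∀ x y z, ∑ i, μ x y i • μ (Pi.single i 1) z = 0) ∧
  (∀ a x z b y w i, μ a b i * (μ x y i * μ z w i - μ x w i * μ z y i)
    - μ a y i * (μ x b i * μ z w i - μ x w i * μ z b i)
    + μ a w i * (μ x b i * μ z y i - μ x y i * μ z b i) = 0)

lemma C3_closed : IsClosed {μ : Bil n | C3 μ} := by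
  refine IsClosed.inter ?_ (IsClosed.inter ?_ (IsClosed.inter ?_ ?_))
  · exact closed_all fun x => closed_all fun y => isClosed_eq (cont_eval x y) (cont_eval y x)
  · refine closed_all fun x => closed_all fun y => closed_all fun z => closed_all fun w =>
      closed_all fun i => closed_all fun j => ?_
    exact isClosed_eq ((cont_eval' _ _ _).mul (cont_eval' _ _ _))
      ((cont_eval' _ _ _).mul (cont_eval' _ _ _))
  · refine closed_all fun x => closed_all fun y => closed_all fun z => ?_
    exact isClosed_eq (continuous_finsetSum _ fun i _ =>
      (cont_eval' x y i).smul (cont_eval _ z)) continuous_const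
  · refine closed_all fun a => closed_all fun x => closed_all fun z => closed_all fun b =>
      closed_all fun y => closed_all fun w => closed_all fun i => ?_
    have := fun p q : V n => cont_eval' p q i
    refine isClosed_eq ?_ continuous_const
    exact ((this a b).mul (((this x y).mul (this z w)).sub ((this x w).mul (this z y)))).sub
      ((this a y).mul (((this x b).mul (this z w)).sub ((this x w).mul (this z b)))) |>.add
      ((this a w).mul (((this x b).mul (this z y)).sub ((this x y).mul (this z b))))

lemma C3_of {l : Bil n} {g h : Module.Dual ℂ (V n)} {v : V n}
    (H : ∀ x y, l x y = (g x * h y + h x * g y) • v) (gv : g v = 0) (hv : h v = 0) : C3 l := by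
  refine ⟨fun x y => ?_, fun x y z w i j => ?_, fun x y z => ?_, fun a x z b y w i => ?_⟩
  · rw [H, H]; congr 1; ring
  · simp [H]; ring
  · rw [← expand, H x y, H]; simp [gv, hv]
  · simp [H]; ring

lemma C3_cls (hn : 3 ≤ n) {μ : Bil n} (h : C3 μ) :
    (∃ (g : Module.Dual ℂ (V n)) (v : V n), g v = 0 ∧ ∀ x y, μ x y = (g x * g y) • v) ∨
    Isom μ (J3 n) := by
  obtain ⟨hs, hp, hz, hd⟩ := h
  by_cases h0 : μ = 0
  · left; exact ⟨0, 0, by simp, by simp [h0]⟩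
  obtain ⟨x0, i0, hc⟩ := sym_nz hs h0
  set c := μ x0 x0 i0 with hcdef
  set v : V n := c⁻¹ • μ x0 x0 with hv
  have hq : ∀ x y, μ x y = (μ x y i0) • v := by
    intro x y
    ext j
    have := hp x y x0 x0 i0 j
    simp only [hv, Pi.smul_apply, smul_eq_mul]
    field_simp
    rw [← hcdef] at this
    linear_combination -this
  have hv0 : v ≠ 0 := by
    intro h
    have := hq x0 x0
    rw [h, smul_zero] at this
    rw [this] at hcdef
    exact hc hcdef
  have hvz : ∀ z, μ v z = 0 := by
    intro z
    have := hz x0 x0 z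
    rw [← expand] at this
    rw [hv, map_smul, LinearMap.smul_apply, this, smul_zero]
  clear_value v
  let a : Module.Dual ℂ (V n) := pj i0 ∘ₗ μ x0
  have ha : ∀ x, a x = μ x0 x i0 := fun x => rfl
  have av : a v = 0 := by rw [ha, hs, hvz]; rfl
  have ax0 : a x0 = c := rfl
  have hr : ∀ x y z w, (c * μ x y i0 - a x * a y) * (c * μ z w i0 - a z * a w) =
      (c * μ x w i0 - a x * a w) * (c * μ z y i0 - a z * a y) := by
    intro x y z w
    have := hd x0 x z x0 y w i0
    rw [hs x x0, hs z x0, ← hcdef] at this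
    simp only [ha]
    linear_combination c * this
  by_cases hr0 : ∀ x, c * μ x x i0 - a x * a x = 0
  · left
    refine ⟨a, c⁻¹ • v, by simp [av], fun x y => ?_⟩
    have : c * μ x y i0 = a x * a y := by
      have h1 := hr0 (x + y)
      have h2 := hr0 x
      have h3 := hr0 y
      have h4 : μ y x i0 = μ x y i0 := by rw [hs]
      simp [h4] at h1
      linear_combination (h1 - h2 - h3) / 2
    rw [hq, smul_smul]
    congr 1
    field_simp
    linear_combination this
  · right
    push Not at hr0
    obtain ⟨x1, hd1⟩ := hr0
    set d := c * μ x1 x1 i0 - a x1 * a x1 with hdd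
    let k : Module.Dual ℂ (V n) := c • (pj i0 ∘ₗ μ x1) - a x1 • a
    have hk : ∀ x, k x = c * μ x1 x i0 - a x1 * a x := fun x => rfl
    have kv : k v = 0 := by
      rw [hk, av, hs, hvz]; simp
    have kx0 : k x0 = 0 := by rw [hk, ax0, hs, ← ha]; ring
    have kx1 : k x1 = d := rfl
    have hq2 : ∀ x y, c * μ x y i0 = a x * a y + k x * k y * d⁻¹ := by
      intro x y
      have := hr x1 x1 x y
      rw [← hdd, hs x x1, ← hk] at this
      have h2 : c * μ x1 x i0 - a x * a x1 = k x := by rw [hk]; ring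
      rw [h2] at this
      field_simp
      linear_combination this
    obtain ⟨σ, hσ⟩ := IsAlgClosed.exists_pow_nat_eq (-d⁻¹) (n := 2) (by norm_num)
    have σ0 : σ ≠ 0 := by
      rintro rfl
      simp at hσ
      exact hd1 hσ
    let X0 : V n := c⁻¹ • x0
    let X1 : V n := d⁻¹ • (x1 - (a x1 * c⁻¹) • x0)
    have aX0 : a X0 = 1 := by simp [X0, ax0, hc]
    have kX0 : k X0 = 0 := by simp [X0, kx0]
    have aX1 : a X1 = 0 := by simp [X1, ax0, hc]
    have kX1 : k X1 = 1 := by simp [X1, kx0, kx1, hd1]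
    refine isoJ3 hn (g := a + σ • k) (h := (2⁻¹ : ℂ) • (a - σ • k))
      (u := (2⁻¹ : ℂ) • X0 + (2 * σ)⁻¹ • X1) (w := X0 - σ⁻¹ • X1) (v := c⁻¹ • v)
      (fun x y => ?_) ?_ ?_ ?_ ?_ ?_ ?_ ?_
    · rw [hq, smul_smul]
      congr 1
      have := hq2 x y
      simp
      field_simp
      have h3 : d⁻¹ = - σ ^ 2 := by rw [hσ]; ring
      rw [h3] at this
      linear_combination 2 * this
    · simp [aX0, aX1, kX0, kX1]; field_simp; norm_num
    · simp [aX0, aX1, kX0, kX1, σ0]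
    · simp [av, kv]
    · simp [aX0, aX1, kX0, kX1]; field_simp; norm_num
    · simp [aX0, aX1, kX0, kX1]; field_simp; norm_num
    · simp [av, kv]
    · simp [hc, hv0]

lemma lvl_J3 (hn : 3 ≤ n) : levelTwo (J3 n) := by
  have hJ := J3_apply hn
  have hcl : closure (orb (J3 n)) ⊆ {ν | C3 ν} := by
    refine closure_minimal ?_ C3_closed
    rintro _ ⟨G, rfl⟩
    refine C3_of (g := pj ⟨0, by omega⟩ ∘ₗ G.symm.toLinearMap)
      (h := pj ⟨1, by omega⟩ ∘ₗ G.symm.toLinearMap) (v := G (E n 2)) (fun x y => ?_) ?_ ?_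
    · simp [act_apply, hJ]
    · simp [pj_apply, E_apply]
    · simp [pj_apply, E_apply]
  constructor
  · rintro μ ⟨hμ, hμ'⟩
    rcases C3_cls hn (hcl hμ) with ⟨g, v, gv, h⟩ | h
    · exact nil_level h gv
    · exact absurd h.symm hμ'
  · obtain ⟨μ, hμ, g, v, gv, hg, hv, h⟩ := degen2 (J3 n) (pj ⟨0, by omega⟩)
      (pj ⟨2, by omega⟩) (E n 0 + E n 1) (E n 2)
      (by simp [pj_apply, E_apply]) (by simp [pj_apply, E_apply]) (by simp [pj_apply, E_apply])
      (by simp [pj_apply, E_apply]) (by simp [hJ, pj_apply, E_apply])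
    refine ⟨μ, ⟨hμ, ?_⟩, ?_⟩
    · rintro ⟨G, rfl⟩
      have h1 := h (G (E n 0)) (G (E n 0))
      have h2 := h (G (E n 0)) (G (E n 1))
      simp only [act_apply, LinearEquiv.symm_apply_apply, hJ] at h1 h2
      have a1 : pj (n := n) ⟨0, by omega⟩ (E n 0) = 1 := by simp [pj_apply, E_apply]
      have a2 : pj (n := n) ⟨1, by omega⟩ (E n 0) = 0 := by simp [pj_apply, E_apply]
      have a3 : pj (n := n) ⟨0, by omega⟩ (E n 1) = 0 := by simp [pj_apply, E_apply]
      have a4 : pj (n := n) ⟨1, by omega⟩ (E n 1) = 1 := by simp [pj_apply, E_apply]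
      rw [a1, a2] at h1
      rw [a1, a2, a3, a4] at h2
      simp only [mul_zero, zero_mul, mul_one, add_zero, zero_add, zero_smul, one_smul,
        map_zero] at h1 h2
      rcases smul_eq_zero.1 h1.symm with h1 | h1
      · rw [mul_self_eq_zero.1 h1, zero_mul, zero_smul] at h2
        have h3 : E n 2 = 0 := by simpa only [LinearEquiv.map_eq_zero_iff] using h2
        have := congrFun h3 ⟨2, by omega⟩
        simp [E_apply] at this
      · exact hv h1
    · rintro rfl
      obtain ⟨u, hu⟩ := LinearMap.surjective hg 1
      have := h u u
      simp [hu] at this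
      exact hv this.symm

/-- hyperbolic pair -/
lemma hyp (l : Bil n) (hs : ∀ x y, l x y = l y x) (H : ¬ HH l) :
    ∃ (φ : Module.Dual ℂ (V n)) (u v : V n), φ u = 0 ∧ φ v = 0 ∧ φ (l u u) = 0 ∧ φ (l v v) = 0 ∧
      φ (l u v) = 1 := by
  unfold HH at H
  push Not at H
  obtain ⟨φ, u, v, hu, hv, hne⟩ := H
  refine ⟨φ, ?_⟩
  have hvu : l v u = l u v := hs _ _
  by_cases huu : φ (l u u) = 0
  · have huv : φ (l u v) ≠ 0 := by
      intro h; apply hne; rw [huu, h]; simp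
    refine ⟨u, (φ (l u v))⁻¹ • (v - (φ (l v v) / (2 * φ (l u v))) • u), hu, by simp [hu, hv], huu,
      ?_, ?_⟩
    · simp [huu, hvu]; field_simp; ring_nf; simp
    · simp [huu, huv]
  · obtain ⟨s, hs2⟩ := IsAlgClosed.exists_pow_nat_eq
      (φ (l u v) ^ 2 - φ (l u u) * φ (l v v)) (n := 2) (by norm_num)
    have s0 : s ≠ 0 := by
      rintro rfl
      apply hne
      linear_combination hs2
    set A := φ (l u u) with hA
    set B := φ (l u v) with hB
    set C := φ (l v v) with hC
    refine ⟨v + ((-B + s) / A) • u, (- A / (2 * s ^ 2)) • (v + ((-B - s) / A) • u),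
      by simp [hu, hv], by simp [hu, hv], ?_, ?_, ?_⟩
    · simp [hvu, ← hA, ← hB, ← hC]
      field_simp
      linear_combination hs2
    · simp only [map_add, map_smul, LinearMap.add_apply, LinearMap.smul_apply, hvu, ← hA, ← hB,
        ← hC, smul_eq_mul]
      field_simp
      linear_combination A * hs2
    · simp only [map_add, map_smul, LinearMap.add_apply, LinearMap.smul_apply, hvu, ← hA, ← hB,
        ← hC, smul_eq_mul]
      field_simp
      linear_combination -hs2

lemma degen3 (hn : 3 ≤ n) (l : Bil n) (hs : ∀ x y, l x y = l y x) (H : ¬ HH l) :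
    ∃ μ ∈ closure (orb l), Isom μ (J3 n) := by
  obtain ⟨φ, u, v, hu, hv, huu, hvv, huv⟩ := hyp l hs H
  have hvu : φ (l v u) = 1 := by rw [hs, huv]
  obtain ⟨z, hz⟩ := LinearMap.surjective (f := φ) (by rintro rfl; simp at huv) 1
  let D1 : Module.Dual ℂ (V n) := φ ∘ₗ l v - φ (l v z) • φ
  let D2 : Module.Dual ℂ (V n) := φ ∘ₗ l u - φ (l u z) • φ
  have d1u : D1 u = 1 := by simp [D1, hvu, hu]
  have d1v : D1 v = 0 := by simp [D1, hvv, hv]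
  have d1z : D1 z = 0 := by simp [D1, hz]
  have d2u : D2 u = 0 := by simp [D2, huu, hu]
  have d2v : D2 v = 1 := by simp [D2, huv, hv]
  have d2z : D2 z = 0 := by simp [D2, hz]
  let a : V n →ₗ[ℂ] V n := D1.smulRight u + D2.smulRight v
  let r : V n →ₗ[ℂ] V n := φ.smulRight z
  have ha : ∀ x, a x = D1 x • u + D2 x • v := fun x => rfl
  have hr : ∀ x, r x = φ x • z := fun x => rfl
  clear_value D1 D2 a r
  refine ⟨(l.compl₁₂ a a).compr₂ r, ?_, ?_⟩
  · refine degen l a (LinearMap.id - a - r) r ?_ ?_ ?_ ?_ ?_ ?_ ?_ ?_ ?_ ?_ _ (fun x y => rfl) <;>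
      intro x <;> simp [ha, hr, d1u, d1v, d1z, d2u, d2v, d2z, hz, hu, hv] <;> abel
  · refine isoJ3 hn (g := D1) (h := D2) (u := u) (w := v) (v := z) (fun x y => ?_)
      d1u d1v d1z d2u d2v d2z (by rintro rfl; simp at hz)
    simp only [LinearMap.compr₂_apply, LinearMap.compl₁₂_apply, ha, hr, map_smul, map_add,
      LinearMap.smul_apply, LinearMap.add_apply, smul_eq_mul, huu, hvv, huv, hvu]
    congr 1; ring

lemma not_of_closure {l : Bil n} (h : levelTwo l) (h' : closure (orb l) ⊆ orb l ∪ {0}) : False := by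
  obtain ⟨-, μ, ⟨h1, h2⟩, h3⟩ := h
  rcases h' h1 with h | h
  · exact h2 h
  · exact h3 h

end partY

/-- classification of Jordan multiplications of level two. -/
theorem jordan_level_two (n : ℕ) (hn : 3 ≤ n) (lam : Bil n) (hJ : JordanMul lam) :
    levelTwo lam ↔ (Isom lam (J1 n) ∨ Isom lam (J2 n) ∨ Isom lam (J3 n)) := by
  constructor
  · intro h2
    obtain ⟨hs, hj⟩ := hJ
    by_cases H : HH lam
    · have hfr : 3 ≤ Module.finrank ℂ (V n) := by simpa using hn
      have h0 : 0 < n := by omega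
      have p0 : pj ⟨0, h0⟩ (E n 0) = 1 := by simp [pj_apply, E_apply]
      rcases jordan_FG hfr lam hj (HH_FG hfr lam hs H) with ⟨f, h⟩ | ⟨g, v, h⟩ | ⟨f, v, fv, h⟩
      · exact (not_of_closure h2 (nu_not h)).elim
      · by_cases gv : g v = 0
        · exact (not_of_closure h2 (nil_level h gv)).elim
        · left
          refine iso_R1 (g := g v • g) (v := (g v ^ 2)⁻¹ • v) (fun x y => ?_) (J1_apply h0) ?_ p0
          · rw [h, smul_smul]
            congr 1
            simp; field_simp
          · simp; field_simp
      · right; left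
        exact iso_F2 h (J2_apply h0) fv p0
    · right; right
      obtain ⟨μ, hμ, hi⟩ := degen3 hn lam hs H
      by_cases hm : μ ∈ orb lam
      · exact (mem_orb.1 hm).trans hi
      · have := h2.1 μ ⟨hμ, hm⟩
        rw [hi.orb_eq] at this
        exact (not_of_closure (lvl_J3 hn) this).elim
  · rintro (h | h | h)
    · exact (levelTwo_iff_of_isom h).2 (lvl_J1 hn)
    · exact (levelTwo_iff_of_isom h).2 (lvl_J2 hn)
    · exact (levelTwo_iff_of_isom h).2 (lvl_J3 hn)
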